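/- arXiv:math/0207025 — 2 statements merged into one kernel-verified Lean document; each statement's English description precedes it below -/
import Mathlib

section
/- Let R be a commutative ring containing ℚ, let τ ∈ R, and let M be an R-module. Let a : ℕ → M and b : {1,2,3,…} → M be sequences. Then the following two conditions are equivalent: (i) for every k ≥ 0, a_k = ∑_{n=1}^{k+1} (−τ)^{k−n+1} · h_{k−n+1}(1, 1/2, …, 1/n) · (1/n!) · b_n; (ii) for every n ≥ 1, b_n = n · ∑_{k=1}^{n} τ^{k−1} · s(n,k) · a_{n−k}. (This is the inversion, proved in the Appendix, between the generating-function relation ∑_{k≥0} z^{k+1} ∂_k = ∑_{n≥1} z^n δ_n / ((1+zτ)(2+zτ)⋯(n+zτ)) and the relation δ_n = n ∑_{k=1}^n τ^{k−1} s(n,k) ∂_{n−k}.) -/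
/-- The complete homogeneous symmetric polynomial `h_j` evaluated at the
rational numbers `1, 1/2, …, 1/N` (the sum over all multisets of size `j`
of indices of the corresponding products). -/
noncomputable def completeHomog (N j : ℕ) : ℚ :=
  ∑ m : Sym (Fin N) j, ((m : Multiset (Fin N)).map (fun i => (1 : ℚ) / ((i : ℕ) + 1))).prod

/-- The unsigned Stirling number of the first kind `s(n,k)`, defined as the
coefficient of `X^k` in the ascending factorial `X(X+1)⋯(X+n-1)`. -/
noncomputable def stirlingFirst (n k : ℕ) : ℚ := (ascPochhammer ℚ n).coeff k

namespace TodaInv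

open Finset

noncomputable def hh (α : Type) [Fintype α] [DecidableEq α] (f : α → ℚ) (j : ℕ) : ℚ :=
  ∑ m : Sym α j, ((m : Multiset α).map f).prod

lemma hh_zero (α : Type) [Fintype α] [DecidableEq α] (f : α → ℚ) : hh α f 0 = 1 := by
  unfold hh
  rw [Fintype.sum_unique]
  have : ((default : Sym α 0) : Multiset α) = 0 := rfl
  simp [this]

lemma hh_option (α : Type) [Fintype α] [DecidableEq α] (f : Option α → ℚ) (j : ℕ) :
    hh (Option α) f (j + 1) = f none * hh (Option α) f j + hh α (fun x => f (some x)) (j + 1) := by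
  unfold hh
  rw [← (symOptionSuccEquiv (α := α) (n := j)).symm.sum_comp, Fintype.sum_sum_type, Finset.mul_sum]
  congr 1
  · refine Finset.sum_congr rfl fun m _ => ?_
    have : (symOptionSuccEquiv (α := α) (n := j)).symm (Sum.inl m) = none ::ₛ m := rfl
    rw [this, Sym.coe_cons, Multiset.map_cons, Multiset.prod_cons]
  · refine Finset.sum_congr rfl fun m _ => ?_
    have : (symOptionSuccEquiv (α := α) (n := j)).symm (Sum.inr m)
      = m.map Function.Embedding.some := rfl
    rw [this]
    simp [Multiset.map_map]

lemma hh_congr (α β : Type) [Fintype α] [DecidableEq α] [Fintype β] [DecidableEq β] (e : α ≃ β)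
    (f : β → ℚ) (j : ℕ) : hh β f j = hh α (fun x => f (e x)) j := by
  unfold hh
  rw [← (Sym.equivCongr (n := j) e).sum_comp]
  refine Finset.sum_congr rfl fun m _ => ?_
  have : (Sym.equivCongr (n := j) e) m = m.map e := rfl
  rw [this]
  simp [Multiset.map_map]

lemma ch_eq (n j : ℕ) : completeHomog n j = hh (Fin n) (fun i => (1 : ℚ) / ((i : ℕ) + 1)) j := by
  unfold completeHomog hh
  refine Finset.sum_congr rfl fun m _ => ?_
  simp [Multiset.bind_def, Multiset.pure_def, Multiset.map_bind, Multiset.map_map,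
    Multiset.bind_singleton]

lemma ch_zero (n : ℕ) : completeHomog n 0 = 1 := by
  rw [ch_eq, hh_zero]

lemma ch_succ (n j : ℕ) : completeHomog (n + 1) (j + 1) =
    (1 / ((n : ℚ) + 1)) * completeHomog (n + 1) j + completeHomog n (j + 1) := by
  simp only [ch_eq]
  rw [hh_congr _ _ (finSuccEquivLast (n := n)).symm, hh_option,
    hh_congr _ _ (finSuccEquivLast (n := n)).symm]
  simp

lemma ch_nil (j : ℕ) : completeHomog 0 (j + 1) = 0 := by
  unfold completeHomog
  have : IsEmpty (Sym (Fin 0) (j + 1)) := by infer_instance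
  simp

noncomputable def c (m n : ℕ) : ℚ :=
  if n ≤ m then (-1) ^ (m - n) * (completeHomog n (m - n) * (1 / (n.factorial : ℚ))) else 0

noncomputable def d (n m : ℕ) : ℚ :=
  if m ≤ n + 1 then stirlingFirst n (n + 1 - m) else 0

lemma c_rec (m n : ℕ) : ((n : ℚ) + 1) * c (m + 1) (n + 1) = c m n - c m (n + 1) := by
  have hf : (n.factorial : ℚ) ≠ 0 := by positivity
  have hn : (n : ℚ) + 1 ≠ 0 := by positivity
  unfold c
  rcases lt_trichotomy n m with h | h | h
  · obtain ⟨j, rfl⟩ : ∃ j, m = n + 1 + j := ⟨m - (n + 1), by omega⟩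
    rw [if_pos (by omega), if_pos (by omega), if_pos (by omega)]
    rw [show n + 1 + j + 1 - (n + 1) = j + 1 by omega, show n + 1 + j - n = j + 1 by omega,
      show n + 1 + j - (n + 1) = j by omega, ch_succ, Nat.factorial_succ]
    push_cast
    field_simp
    ring
  · subst h
    simp [ch_zero, Nat.factorial_succ]
    field_simp
  · rw [if_neg (by omega), if_neg (by omega), if_neg (by omega)]
    simp

lemma s_zero (n : ℕ) : (n : ℚ) * stirlingFirst n 0 = 0 := by
  unfold stirlingFirst
  rcases n with _ | n
  · simp
  · rw [ascPochhammer_succ_left]; simp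

lemma s_succ (n k : ℕ) :
    stirlingFirst (n + 1) (k + 1) = stirlingFirst n k + n * stirlingFirst n (k + 1) := by
  unfold stirlingFirst
  rw [ascPochhammer_succ_right, mul_add, Polynomial.coeff_add, Polynomial.coeff_mul_X,
    ← Polynomial.C_eq_natCast, Polynomial.coeff_mul_C]
  ring

lemma s_succ_zero (n : ℕ) : stirlingFirst (n + 1) 0 = 0 := by
  unfold stirlingFirst
  rw [ascPochhammer_succ_left]; simp

lemma d_rec (n m : ℕ) : d (n + 1) (m + 1) = d n (m + 1) + n * d n m := by
  unfold d
  rcases lt_trichotomy m (n + 1) with h | h | h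
  · obtain ⟨j, rfl⟩ : ∃ j, n = m + j := ⟨n - m, by omega⟩
    rw [if_pos (by omega), if_pos (by omega), if_pos (by omega)]
    rw [show m + j + 1 + 1 - (m + 1) = j + 1 by omega, show m + j + 1 - (m + 1) = j by omega,
      show m + j + 1 - m = j + 1 by omega, s_succ]
  · subst h
    simp [s_succ_zero, s_zero]
  · rw [if_neg (by omega), if_neg (by omega), if_neg (by omega)]
    simp

lemma d_zero (n : ℕ) : d n 0 = 0 := by
  unfold d stirlingFirst
  rw [if_pos (by omega)]
  apply Polynomial.coeff_eq_zero_of_natDegree_lt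
  rw [ascPochhammer_natDegree]; omega

lemma d_lt (n p : ℕ) (h : n < p) : d (n + 1) (p + 1) = 0 := by
  unfold d
  split_ifs with h1
  · have : p = n + 1 := by omega
    subst this
    simp [s_succ_zero]
  · rfl

lemma c0 (m : ℕ) : c m 0 = if m = 0 then 1 else 0 := by
  unfold c
  rcases m with _ | m
  · simp [ch_zero]
  · simp [ch_nil]

lemma d0 (p : ℕ) : d 0 (p + 1) = if p = 0 then 1 else 0 := by
  unfold d
  rcases p with _ | p
  · simp [stirlingFirst]
  · simp

noncomputable def S (m p : ℕ) : ℚ := ∑ n ∈ range (m + 1), c m n * (n * d n p)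

lemma S_succ (m p : ℕ) : S (m + 1) (p + 1) = S m p + if m = 0 ∧ p = 0 then 1 else 0 := by
  unfold S
  rw [sum_range_succ']
  have h1 : ∀ n ∈ range (m + 1), c (m + 1) (n + 1) * (((n + 1 : ℕ) : ℚ) * d (n + 1) (p + 1))
      = (c m n * d n (p + 1) + c m n * (n * d n p)) - c m (n + 1) * d (n + 1) (p + 1) := by
    intro n _
    have := c_rec m n
    have h2 := d_rec n p
    push_cast
    calc _ = (((n : ℚ) + 1) * c (m + 1) (n + 1)) * d (n + 1) (p + 1) := by ring
      _ = c m n * d (n + 1) (p + 1) - c m (n + 1) * d (n + 1) (p + 1) := by rw [this]; ring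
      _ = _ := by rw [← mul_add, ← h2]
  rw [sum_congr rfl h1, sum_sub_distrib, sum_add_distrib]
  have h3 := sum_range_succ' (fun n => c m n * d n (p + 1)) (m + 1)
  rw [sum_range_succ] at h3
  have h4 : c m (m + 1) = 0 := by simp [c]
  rw [h4, c0, d0] at h3
  have h5 : (if m = 0 ∧ p = 0 then (1 : ℚ) else 0)
    = (if m = 0 then (1 : ℚ) else 0) * (if p = 0 then (1 : ℚ) else 0) := by
    split_ifs <;> simp_all
  rw [h5]
  simp only [Nat.cast_zero, zero_mul, mul_zero, add_zero] at *
  linarith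

lemma S_eq (m p : ℕ) : S (m + 1) (p + 1) = if m = p then 1 else 0 := by
  induction m generalizing p with
  | zero =>
    rw [S_succ]
    have : S 0 p = 0 := by simp [S]
    rw [this]
    simp [eq_comm]
  | succ m ih =>
    rw [S_succ]
    rcases p with _ | p
    · have : S (m + 1) 0 = 0 := by simp [S, d_zero]
      rw [this]; simp
    · rw [ih]; simp

lemma tri (R : Type*) [CommRing R] [Algebra ℚ R] (τ : R)
    (M : Type*) [AddCommGroup M] [Module R M] (P Q : ℕ → ℕ → ℚ)
    (hPQ : ∀ k p, ∑ n ∈ range (k + 1), P k n * Q n p = if k = p then 1 else 0)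
    (hQ : ∀ n p, n < p → Q n p = 0) (hP : ∀ k, P k k ≠ 0)
    (a b : ℕ → M) :
    (∀ k, a k = ∑ n ∈ range (k + 1), (τ ^ (k - n) * algebraMap ℚ R (P k n)) • b n) ↔
    (∀ n, b n = ∑ p ∈ range (n + 1), (τ ^ (n - p) * algebraMap ℚ R (Q n p)) • a p) := by
  have key : ∀ b' : ℕ → M,
      (∀ n, b' n = ∑ p ∈ range (n + 1), (τ ^ (n - p) * algebraMap ℚ R (Q n p)) • a p) →
      (∀ k, a k = ∑ n ∈ range (k + 1), (τ ^ (k - n) * algebraMap ℚ R (P k n)) • b' n) := by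
    intro b' hb k
    have h1 : ∀ n ∈ range (k + 1), (τ ^ (k - n) * algebraMap ℚ R (P k n)) • b' n =
        ∑ p ∈ range (k + 1), (τ ^ (k - p) * algebraMap ℚ R (P k n * Q n p)) • a p := by
      intro n hn
      rw [mem_range] at hn
      rw [hb n, smul_sum]
      have : range (n + 1) ⊆ range (k + 1) := range_subset_range.2 (by omega)
      rw [← sum_subset this]
      · refine sum_congr rfl fun p hp => ?_
        rw [mem_range] at hp
        rw [smul_smul, show k - p = (k - n) + (n - p) by omega, pow_add, map_mul]
        congr 1
        ring
      · intro p _ hp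
        rw [mem_range] at hp
        rw [hQ n p (by omega)]
        simp
    rw [sum_congr rfl h1, sum_comm]
    have h2 : ∀ p ∈ range (k + 1),
        ∑ n ∈ range (k + 1), (τ ^ (k - p) * algebraMap ℚ R (P k n * Q n p)) • a p
        = if k = p then a p else 0 := by
      intro p _
      rw [← sum_smul, ← mul_sum, ← map_sum, hPQ]
      split_ifs with h
      · subst h; simp
      · simp
    rw [sum_congr rfl h2]
    simp
  refine ⟨fun h => ?_, key b⟩
  set b' : ℕ → M :=
    fun n => ∑ p ∈ range (n + 1), (τ ^ (n - p) * algebraMap ℚ R (Q n p)) • a p with hb'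
  have h' := key b' (fun n => rfl)
  intro n
  change b n = b' n
  induction n using Nat.strong_induction_on with
  | _ n ih =>
    have e := (h n).symm.trans (h' n)
    rw [sum_range_succ, sum_range_succ, sum_congr rfl (fun i hi => by
      rw [ih i (mem_range.1 hi)])] at e
    have e2 := add_left_cancel e
    have e3 := congrArg (fun x => algebraMap ℚ R (P n n)⁻¹ • x) e2
    simpa [smul_smul, ← map_mul, inv_mul_cancel₀ (hP n)] using e3

lemma sum_Icc_shift {M : Type*} [AddCommMonoid M] (f : ℕ → M) (k : ℕ) :
    ∑ n ∈ Icc 1 (k + 1), f n = ∑ i ∈ range (k + 1), f (i + 1) := by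
  rw [range_eq_Ico, sum_Ico_add']
  rfl

lemma rhs_eq (R : Type*) [CommRing R] [Algebra ℚ R] (τ : R)
    (M : Type*) [AddCommGroup M] [Module R M] (a : ℕ → M) (n : ℕ) :
    ((n + 1 : ℕ) : R) • ∑ k ∈ Icc 1 (n + 1),
        (τ ^ (k - 1) * algebraMap ℚ R (stirlingFirst (n + 1) k)) • a (n + 1 - k)
    = ∑ p ∈ range (n + 1),
      (τ ^ (n - p) * algebraMap ℚ R (((n + 1 : ℕ) : ℚ) * d (n + 1) (p + 1))) • a p := by
  rw [sum_Icc_shift, ← sum_range_reflect, smul_sum]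
  refine sum_congr rfl fun p hp => ?_
  rw [mem_range] at hp
  unfold d
  rw [if_pos (by omega), smul_smul, show n + 1 - 1 - p + 1 = n + 1 - p by omega,
    show n + 1 + 1 - (p + 1) = n + 1 - p by omega, show n + 1 - (n + 1 - p) = p by omega,
    show n + 1 - p - 1 = n - p by omega, map_mul, map_natCast]
  congr 1
  ring

end TodaInv


/-- for a commutative ring `R` containing `ℚ`, `τ ∈ R`, an
`R`-module `M` and sequences `a : ℕ → M`, `b` (indexed by positive integers),
the relation `a_k = ∑_{n=1}^{k+1} (−τ)^{k−n+1} h_{k−n+1}(1,…,1/n) (1/n!) b_n`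
for all `k ≥ 0` is equivalent to the relation
`b_n = n ∑_{k=1}^{n} τ^{k−1} s(n,k) a_{n−k}` for all `n ≥ 1`. -/
theorem equivariant_toda_flow_inversion
    (R : Type*) [CommRing R] [Algebra ℚ R] (τ : R)
    (M : Type*) [AddCommGroup M] [Module R M]
    (a : ℕ → M) (b : ℕ → M) :
    (∀ k : ℕ, a k =
      ∑ n ∈ Finset.Icc 1 (k + 1),
        ((-τ) ^ (k + 1 - n) *
          algebraMap ℚ R (completeHomog n (k + 1 - n) * (1 / (n.factorial : ℚ)))) • b n)
    ↔
    (∀ n : ℕ, 1 ≤ n → b n =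
      (n : R) • ∑ k ∈ Finset.Icc 1 n,
        (τ ^ (k - 1) * algebraMap ℚ R (stirlingFirst n k)) • a (n - k)) := by
  have := TodaInv.tri R τ M (fun k n => TodaInv.c (k + 1) (n + 1))
    (fun n p => ((n + 1 : ℕ) : ℚ) * TodaInv.d (n + 1) (p + 1)) ?_ ?_ ?_ a (fun n => b (n + 1))
  · convert! this using 1
    · refine forall_congr' fun k => ?_
      rw [TodaInv.sum_Icc_shift]
      have : ∀ i ∈ Finset.range (k + 1), ((-τ) ^ (k + 1 - (i + 1)) * algebraMap ℚ R
          (completeHomog (i + 1) (k + 1 - (i + 1)) * (1 / ((i + 1).factorial : ℚ)))) • b (i + 1)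
          = (τ ^ (k - i) * algebraMap ℚ R (TodaInv.c (k + 1) (i + 1))) • b (i + 1) := by
        intro i hi
        rw [Finset.mem_range] at hi
        unfold TodaInv.c
        rw [if_pos (by omega), show k + 1 - (i + 1) = k - i by omega,
          map_mul (algebraMap ℚ R) ((-1) ^ (k - i)), ← mul_assoc, neg_pow τ]
        simp [mul_comm]
      rw [Finset.sum_congr rfl this]
    · refine ⟨fun h n => ?_, fun h n hn => ?_⟩
      · rw [h (n + 1) (by omega)]
        exact TodaInv.rhs_eq R τ M a n
      · obtain ⟨m, rfl⟩ : ∃ m, n = m + 1 := ⟨n - 1, by omega⟩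
        rw [h m]
        exact (TodaInv.rhs_eq R τ M a m).symm
  · intro k p
    have := TodaInv.S_eq k p
    unfold TodaInv.S at this
    rw [Finset.sum_range_succ'] at this
    simpa using this
  · intro n p h
    simp [TodaInv.d_lt n p h]
  · intro k
    simp [TodaInv.c, TodaInv.ch_zero, Nat.factorial_ne_zero]
end

section
/- For all integers n ≥ 1 and m ≥ 0, the following identity holds in ℚ: ∑_{ℓ=0}^{n−1} (−1)^{ℓ−m+1} · e_{n−ℓ−1}(1, 1/2, …, 1/(n−1)) · h_{ℓ−m+1}(1, 1/2, …, 1/m) = 1 if n = m and 0 otherwise, where summands with ℓ − m + 1 < 0 are zero (by the convention h_j = 0 for j < 0). -/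
/-- The elementary symmetric polynomial `e_j` evaluated at the rational
numbers `1, 1/2, …, 1/N` (the sum over all `j`-element subsets of indices of
the corresponding products). -/
noncomputable def elemSymm (N j : ℕ) : ℚ :=
  ∑ s ∈ Finset.powersetCard j (Finset.univ : Finset (Fin N)),
    ∏ i ∈ s, (1 : ℚ) / ((i : ℕ) + 1)

/-- The complete homogeneous symmetric polynomial `h_j` evaluated at the
rational numbers `1, 1/2, …, 1/N`, extended by `0` for negative degrees `j`. -/
noncomputable def completeHomogZ (N : ℕ) (j : ℤ) : ℚ :=
  if j < 0 then 0
  else ∑ m : Sym (Fin N) j.toNat,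
    ((m : Multiset (Fin N)).map (fun i => (1 : ℚ) / ((i : ℕ) + 1))).prod

open Finset in
theorem aux_hopt {α : Type*} [Fintype α] [DecidableEq α] (f : Option α → ℚ) (j : ℕ) :
    ∑ m : Sym (Option α) (j+1), ((m : Multiset (Option α)).map f).prod
      = f none * ∑ m : Sym (Option α) j, ((m : Multiset (Option α)).map f).prod
        + ∑ m : Sym α (j+1), ((m : Multiset α).map (fun a => f (some a))).prod := by
  rw [← Equiv.sum_comp (symOptionSuccEquiv (α := α) (n := j)).symm
    (fun m : Sym (Option α) (j+1) => ((m : Multiset (Option α)).map f).prod), Fintype.sum_sum_type, mul_sum]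
  congr 1
  · refine sum_congr rfl fun s _ => ?_
    change (((none ::ₛ s : Sym (Option α) (j+1)) : Multiset (Option α)).map f).prod = _
    rw [Sym.coe_cons, Multiset.map_cons, Multiset.prod_cons]
  · refine sum_congr rfl fun s _ => ?_
    change (((s.map Function.Embedding.some : Sym (Option α) (j+1)) : Multiset (Option α)).map f).prod = _
    simp [Sym.coe_map]

noncomputable def auxH (x : ℕ → ℚ) (N j : ℕ) : ℚ :=
  ∑ m : Sym (Fin N) j, ((m : Multiset (Fin N)).map (fun i : Fin N => x i)).prod

theorem auxH_equiv {α β : Type*} [Fintype α] [DecidableEq α] [Fintype β] [DecidableEq β]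
    (e : α ≃ β) (f : β → ℚ) (j : ℕ) :
    ∑ m : Sym β j, ((m : Multiset β).map f).prod
      = ∑ m : Sym α j, ((m : Multiset α).map (fun a => f (e a))).prod := by
  rw [← Equiv.sum_comp (Sym.equivCongr e)]
  refine Finset.sum_congr rfl fun s _ => ?_
  simp [Sym.coe_map]

theorem auxH_zero (x : ℕ → ℚ) (N : ℕ) : auxH x N 0 = 1 := by
  simp [auxH, Sym.eq_nil_of_card_zero]

theorem auxH_nil (x : ℕ → ℚ) (j : ℕ) : auxH x 0 (j+1) = 0 := by
  simp [auxH]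

theorem auxH_succ (x : ℕ → ℚ) (N j : ℕ) :
    auxH x (N+1) (j+1) = x N * auxH x (N+1) j + auxH x N (j+1) := by
  unfold auxH
  rw [auxH_equiv (finSuccEquivLast (n := N)).symm, auxH_equiv (finSuccEquivLast (n := N)).symm, aux_hopt]
  simp

open PowerSeries in
noncomputable def auxP (x : ℕ → ℚ) (s : Finset ℕ) : PowerSeries ℚ := ∏ i ∈ s, (1 + C (x i) * X)

open PowerSeries in
noncomputable def auxS (x : ℕ → ℚ) (m : ℕ) : PowerSeries ℚ := mk fun j => (-1)^j * auxH x m j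

open PowerSeries in
theorem auxS_succ (x : ℕ → ℚ) (m : ℕ) : auxS x (m+1) * (1 + C (x m) * X) = auxS x m := by
  ext j
  rw [mul_add, mul_one, ← mul_assoc, mul_comm _ (C (x m)), mul_assoc]
  cases j with
  | zero => simp [auxS, auxH_zero]
  | succ j =>
    rw [map_add, coeff_C_mul, coeff_succ_mul_X]
    simp only [auxS, coeff_mk, auxH_succ]
    ring

open PowerSeries in
theorem auxS_mul (x : ℕ → ℚ) (m : ℕ) : auxP x (Finset.range m) * auxS x m = 1 := by
  induction m with
  | zero =>
    ext j
    cases j with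
    | zero => simp [auxS, auxH_zero, auxP]
    | succ j => simp [auxS, auxH_nil, auxP, coeff_one]
  | succ m ih =>
    rw [auxP, Finset.prod_range_succ, mul_assoc, mul_comm (1 + _), auxS_succ]
    exact ih

open PowerSeries in
theorem auxP_coeff_zero (x : ℕ → ℚ) (s : Finset ℕ) (k : ℕ) (hk : s.card < k) :
    coeff k (auxP x s) = 0 := by
  have : auxP x s = ((∏ i ∈ s, (1 + Polynomial.C (x i) * Polynomial.X) : Polynomial ℚ) : PowerSeries ℚ) := by
    rw [← Polynomial.coeToPowerSeries.ringHom_apply, map_prod]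
    simp [auxP]
  rw [this, Polynomial.coeff_coe]
  apply Polynomial.coeff_eq_zero_of_natDegree_lt
  refine lt_of_le_of_lt (Polynomial.natDegree_prod_le _ _) (lt_of_le_of_lt ?_ hk)
  rw [Finset.card_eq_sum_ones]
  refine Finset.sum_le_sum fun i _ => ?_
  compute_degree

open PowerSeries in
theorem elemSymm_eq (N j : ℕ) :
    elemSymm N j = coeff j (auxP (fun i => (1:ℚ) / (i + 1)) (Finset.range N)) := by
  rw [auxP, Finset.prod_range, Finset.prod_one_add, map_sum, elemSymm, Finset.powersetCard_eq_filter,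
    Finset.sum_filter]
  refine Finset.sum_congr rfl fun t _ => ?_
  rw [Finset.prod_mul_distrib, ← map_prod, Finset.prod_const, coeff_C_mul, coeff_X_pow]
  simp [eq_comm]

theorem completeHomogZ_nat (N j : ℕ) :
    completeHomogZ N (j : ℤ) = auxH (fun i => (1:ℚ) / (i + 1)) N j := by
  simp [completeHomogZ, auxH]

/-- for `n ≥ 1` and `m ≥ 0`,
`∑_{ℓ=0}^{n−1} (−1)^{ℓ−m+1} e_{n−ℓ−1}(1,…,1/(n−1)) h_{ℓ−m+1}(1,…,1/m) = δ_{n,m}`,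
summands with `ℓ − m + 1 < 0` being zero. -/
theorem elem_complete_orthogonality (n m : ℕ) (hn : 1 ≤ n) :
    ∑ ℓ ∈ Finset.range n,
      (-1 : ℚ) ^ ((ℓ : ℤ) - m + 1) * elemSymm (n - 1) (n - ℓ - 1) *
        completeHomogZ m ((ℓ : ℤ) - m + 1)
      = if n = m then 1 else 0 := by
  obtain ⟨N, rfl⟩ : ∃ N, n = N + 1 := ⟨n - 1, by omega⟩
  rcases m with _ | m
  · rw [if_neg (by omega)]
    refine Finset.sum_eq_zero fun l _ => ?_
    have : ((l : ℤ) - (0 : ℕ) + 1) = ((l + 1 : ℕ) : ℤ) := by push_cast; ring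
    rw [this, completeHomogZ_nat, auxH_nil, mul_zero]
  have neg : ∀ l : ℕ, l < m → completeHomogZ (m+1) ((l : ℤ) - (m + 1 : ℕ) + 1) = 0 := by
    intro l hl
    rw [completeHomogZ, if_pos (by push_cast; omega)]
  rcases lt_or_ge N m with h | h
  · rw [if_neg (by omega)]
    refine Finset.sum_eq_zero fun l hl => ?_
    rw [neg l (by have := Finset.mem_range.1 hl; omega), mul_zero]
  obtain ⟨d, rfl⟩ := Nat.exists_eq_add_of_le h
  rw [add_assoc, Finset.sum_range_add, Finset.sum_eq_zero, zero_add]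
  swap
  · intro l hl
    rw [neg l (Finset.mem_range.1 hl), mul_zero]
  set x : ℕ → ℚ := fun i => (1:ℚ) / (i + 1) with hx
  have key : ∑ k ∈ Finset.range (d+1), (-1 : ℚ) ^ (((m + k : ℕ) : ℤ) - (m + 1 : ℕ) + 1)
        * elemSymm (m + (d + 1) - 1) (m + (d+1) - (m + k) - 1) *
        completeHomogZ (m+1) (((m + k : ℕ) : ℤ) - (m + 1 : ℕ) + 1)
      = PowerSeries.coeff d (auxS x (m+1) * auxP x (Finset.range (m + d))) := by
    rw [PowerSeries.coeff_mul, Finset.Nat.sum_antidiagonal_eq_sum_range_succ_mk]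
    refine Finset.sum_congr rfl fun k _ => ?_
    have e1 : (((m + k : ℕ) : ℤ) - (m + 1 : ℕ) + 1) = (k : ℤ) := by push_cast; ring
    have e2 : m + (d+1) - (m + k) - 1 = d - k := by omega
    rw [e1, e2, completeHomogZ_nat, elemSymm_eq, zpow_natCast]
    simp only [auxS, PowerSeries.coeff_mk, ← add_assoc, Nat.add_sub_cancel]
    ring
  rw [key]
  rcases d with _ | d
  · simp [auxS, auxP, auxH_zero]
  · rw [if_neg (by omega)]
    have : auxP x (Finset.range (m + (d+1)))
        = auxP x (Finset.range (m+1)) * auxP x (Finset.Ico (m+1) (m + (d+1))) := by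
      rw [auxP, auxP, auxP, Finset.prod_range_mul_prod_Ico _ (by omega)]
    rw [this, ← mul_assoc, mul_comm (auxS _ _), auxS_mul, one_mul]
    apply auxP_coeff_zero
    simp
    omega
end
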